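/- arXiv:0805.0762 — 6 statements merged into one kernel-verified Lean document; each statement's English description precedes it below -/
import Mathlib

section
/- Let Ā be a unital dendriform algebra and b, c ∈ A. Let Y and Z in Ā[[λ]] be the solutions of the equations Y = 1 + λ c ≺ Y and Z = 1 + λ Z ≻ b respectively. Then the product Y * Z solves the equation X = 1 + λ X ≻ b + λ c ≺ X in Ā[[λ]]. -/
open Finset

section DendriformAug

variable {k : Type} [Field k] [CharZero k]
variable {D : Type} [AddCommGroup D] [Module k D]

/-- Elements of `Ā[[λ]]`, the power series over the augmentation `Ā = k·1 ⊕ D` of a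
dendriform algebra `D` by a unit `1`, represented as a pair consisting of the
scalar-part series and the `D`-part series. -/
abbrev Aug (k D : Type) : Type := (ℕ → k) × (ℕ → D)

/-- The unit `1` of `Ā[[λ]]`. -/
def augOne : Aug k D := (fun n => if n = 0 then 1 else 0, 0)

/-- The embedding of `D` into `Ā[[λ]]` as constant series. -/
def ofD (a : D) : Aug k D := (0, fun n => if n = 0 then a else 0)

/-- Multiplication by the formal parameter `λ` on `Ā[[λ]]`. -/
def lam (x : Aug k D) : Aug k D :=
  (fun n => match n with | 0 => 0 | Nat.succ m => x.1 m,
   fun n => match n with | 0 => 0 | Nat.succ m => x.2 m)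

variable (p s : D →ₗ[k] D →ₗ[k] D)

/-- Cauchy convolution of two `D`-valued series along a bilinear operation on `D`. -/
def conv (b : D →ₗ[k] D →ₗ[k] D) (f g : ℕ → D) : ℕ → D :=
  fun n => ∑ ij ∈ antidiagonal n, b (f ij.1) (g ij.2)

/-- Cauchy convolution of a scalar series with a `D`-valued series. -/
def sconv (t : ℕ → k) (f : ℕ → D) : ℕ → D :=
  fun n => ∑ ij ∈ antidiagonal n, t ij.1 • f ij.2

/-- Cauchy convolution of two scalar series. -/
def kconv (u t : ℕ → k) : ℕ → k :=
  fun n => ∑ ij ∈ antidiagonal n, u ij.1 * t ij.2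

/-- The left dendriform product `≺` on `Ā[[λ]]`, extending `p : D → D → D`
λ-adically, with `1 ≺ a = 0` and `a ≺ 1 = a` for `a ∈ D[[λ]]`
(`1 ≺ 1` being left undefined, no scalar part is produced). -/
def precA (x y : Aug k D) : Aug k D :=
  (0, conv p x.2 y.2 + sconv y.1 x.2)

/-- The right dendriform product `≻` on `Ā[[λ]]`, extending `s : D → D → D`
λ-adically, with `1 ≻ a = a` and `a ≻ 1 = 0` for `a ∈ D[[λ]]`
(`1 ≻ 1` being left undefined, no scalar part is produced). -/
def succA (x y : Aug k D) : Aug k D :=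
  (0, conv s x.2 y.2 + sconv x.1 y.2)

/-- The associative product `x * y = x ≺ y + x ≻ y` on `Ā[[λ]]`, for which the
unit satisfies `a * 1 = 1 * a = a` and `1 * 1 = 1`. -/
def starA (x y : Aug k D) : Aug k D :=
  (kconv x.1 y.1,
   conv p x.2 y.2 + conv s x.2 y.2 + sconv y.1 x.2 + sconv x.1 y.2)

theorem sum_antidiagonal_ite_fst {M : Type} [AddCommMonoid M] (f : ℕ → M) (n : ℕ) :
    ∑ ij ∈ antidiagonal n, (if ij.1 = 0 then f ij.2 else 0) = f n := by
  cases n with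
  | zero => simp
  | succ n => simp [Finset.Nat.sum_antidiagonal_succ]

theorem sum_antidiagonal_ite_snd {M : Type} [AddCommMonoid M] (f : ℕ → M) (n : ℕ) :
    ∑ ij ∈ antidiagonal n, (if ij.2 = 0 then f ij.1 else 0) = f n := by
  cases n with
  | zero => simp
  | succ n => simp [Finset.Nat.sum_antidiagonal_succ']

omit [CharZero k] in
theorem sconv_one (f : ℕ → D) : sconv (fun n => if n = 0 then (1 : k) else 0) f = f := by
  funext n
  simp only [sconv, ite_smul, one_smul, zero_smul]
  exact sum_antidiagonal_ite_fst f n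

omit [CharZero k] in
theorem kconv_one (u : ℕ → k) : kconv (fun n => if n = 0 then (1 : k) else 0) u = u := by
  funext n
  simp only [kconv, ite_mul, one_mul, zero_mul]
  exact sum_antidiagonal_ite_fst u n

omit [CharZero k] in
theorem sconv_const (t : ℕ → k) (a : D) :
    sconv t (fun n => if n = 0 then a else 0) = fun n => t n • a := by
  funext n
  simp only [sconv, smul_ite, smul_zero]
  exact sum_antidiagonal_ite_snd (fun m => t m • a) n

omit [CharZero k] in
theorem conv_const_left (q : D →ₗ[k] D →ₗ[k] D) (a : D) (f : ℕ → D) :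
    conv q (fun n => if n = 0 then a else 0) f = fun n => q a (f n) := by
  funext n
  rw [← sum_antidiagonal_ite_fst (fun m => q a (f m)) n]
  refine Finset.sum_congr rfl fun ij _ => ?_
  split_ifs with h <;> simp [h]

omit [CharZero k] in
theorem conv_const_right (q : D →ₗ[k] D →ₗ[k] D) (f : ℕ → D) (a : D) :
    conv q f (fun n => if n = 0 then a else 0) = fun n => q (f n) a := by
  funext n
  rw [← sum_antidiagonal_ite_snd (fun m => q (f m) a) n]
  refine Finset.sum_congr rfl fun ij _ => ?_
  split_ifs with h <;> simp [h]

omit [CharZero k] in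
theorem ite_one_zero_smul (a : D) (n : ℕ) :
    (if n = 0 then (1 : k) else 0) • a = if n = 0 then a else 0 := by
  split_ifs <;> simp

omit [CharZero k] in
/-- If `y (n + 1) = c ≺ y n + δ n • c` and `y 0 = 0`, then `y ≺ z` satisfies
`(y ≺ z) (n + 1) = c ≺ (y * z + z) n`. -/
theorem conv_succ_of_left_recursion (p s : D →ₗ[k] D →ₗ[k] D)
    (ax1 : ∀ a b c : D, p (p a b) c = p a (p b c + s b c)) (c : D) (y z : ℕ → D)
    (h0 : y 0 = 0) (h : ∀ n, y (n + 1) = p c (y n) + if n = 0 then c else 0) (n : ℕ) :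
    conv p y z (n + 1) = p c (conv p y z n + conv s y z n + z n) := by
  have hz : ∑ ij ∈ antidiagonal n, p (if ij.1 = 0 then c else 0) (z ij.2) = p c (z n) :=
    congrFun (conv_const_left p c z) n
  simp only [conv, Finset.Nat.sum_antidiagonal_succ, h0, h, map_zero, map_add,
    LinearMap.zero_apply, LinearMap.add_apply, zero_add, ax1, Finset.sum_add_distrib,
    map_sum, hz]

omit [CharZero k] in
/-- If `z (n + 1) = z n ≻ b + δ n • b` and `z 0 = 0`, then `y ≻ z` satisfies
`(y ≻ z) (n + 1) = (y * z + y) n ≻ b`. -/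
theorem conv_succ_of_right_recursion (p s : D →ₗ[k] D →ₗ[k] D)
    (ax3 : ∀ a b c : D, s a (s b c) = s (p a b + s a b) c) (b : D) (y z : ℕ → D)
    (h0 : z 0 = 0) (h : ∀ n, z (n + 1) = s (z n) b + if n = 0 then b else 0) (n : ℕ) :
    conv s y z (n + 1) = s (conv p y z n + conv s y z n + y n) b := by
  have hy : ∑ ij ∈ antidiagonal n, s (y ij.1) (if ij.2 = 0 then b else 0) = s (y n) b :=
    congrFun (conv_const_right s y b) n
  simp only [conv, Finset.Nat.sum_antidiagonal_succ', h0, h, map_zero, map_add,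
    LinearMap.add_apply, LinearMap.sum_apply, zero_add, ax3,
    Finset.sum_add_distrib, map_sum, hy]

/-- Let `Ā` be a unital dendriform algebra, `b c ∈ A`, and let `Y, Z ∈ Ā[[λ]]` solve
`Y = 1 + λ c ≺ Y` and `Z = 1 + λ Z ≻ b`.  Then `Y * Z` solves
`X = 1 + λ X ≻ b + λ c ≺ X`. -/
theorem dendriform_YZ_solves_degree_one_one
    (ax1 : ∀ a b c : D, p (p a b) c = p a (p b c + s b c))
    (ax2 : ∀ a b c : D, p (s a b) c = s a (p b c))
    (ax3 : ∀ a b c : D, s a (s b c) = s (p a b + s a b) c)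
    (b c : D) (Y Z : Aug k D)
    (hY : Y = augOne + lam (precA p (ofD c) Y))
    (hZ : Z = augOne + lam (succA s Z (ofD b))) :
    starA p s Y Z =
      augOne + lam (succA s (starA p s Y Z) (ofD b))
        + lam (precA p (ofD c) (starA p s Y Z)) := by
  obtain ⟨u, y⟩ := Y
  obtain ⟨v, z⟩ := Z
  have hu : u = fun n => if n = 0 then 1 else 0 := by
    funext n
    have := congrFun (congrArg Prod.fst hY) n
    cases n <;> simpa [augOne, lam, precA] using this
  have hv : v = fun n => if n = 0 then 1 else 0 := by
    funext n
    have := congrFun (congrArg Prod.fst hZ) n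
    cases n <;> simpa [augOne, lam, succA] using this
  subst hu hv
  have hy0 : y 0 = 0 := by simpa [augOne, lam] using congrFun (congrArg Prod.snd hY) 0
  have hz0 : z 0 = 0 := by simpa [augOne, lam] using congrFun (congrArg Prod.snd hZ) 0
  have hy : ∀ n, y (n + 1) = p c (y n) + if n = 0 then c else 0 := fun n => by
    simpa [augOne, lam, precA, ofD, conv_const_left, sconv_const, ite_one_zero_smul] using
      congrFun (congrArg Prod.snd hY) (n + 1)
  have hz : ∀ n, z (n + 1) = s (z n) b + if n = 0 then b else 0 := fun n => by
    simpa [augOne, lam, succA, ofD, conv_const_right, sconv_const, ite_one_zero_smul] using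
      congrFun (congrArg Prod.snd hZ) (n + 1)
  refine Prod.ext (funext fun n => ?_) (funext fun n => ?_)
  · cases n <;> simp [starA, augOne, lam, precA, succA, kconv_one]
  · cases n with
    | zero => simp [starA, augOne, lam, sconv_one, conv, hy0, hz0]
    | succ n =>
      simp only [starA, augOne, lam, precA, succA, ofD, kconv_one, sconv_one, sconv_const,
        conv_const_left, conv_const_right, ite_one_zero_smul, Prod.snd_add, Pi.add_apply,
        Pi.zero_apply, conv_succ_of_left_recursion p s ax1 c y z hy0 hy,
        conv_succ_of_right_recursion p s ax3 b y z hz0 hz, hy, hz, map_add,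
        LinearMap.add_apply]
      abel

end DendriformAug
end

section
/- Let Ā be a unital dendriform algebra and a, b, c, d ∈ A. Let Y ∈ Ā[[λ]] be the solution of Y = 1 + λ b ≺ Y with inverse Y⁻¹ (solving Y⁻¹ = 1 − λ Y⁻¹ ≻ b), and let Z ∈ Ā[[λ]] be the solution of Z = 1 + λ Z ≻ d with inverse Z⁻¹ (solving Z⁻¹ = 1 − λ d ≺ Z⁻¹). Then E := Y * (Y⁻¹ ≻ a) solves the equation E = a + λ b ≺ E, and F := (c ≺ Z⁻¹) * Z solves the equation F = c + λ F ≻ d, in Ā[[λ]]. -/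
open Finset

section Convolution

variable {k : Type} [Field k] {D : Type} [AddCommGroup D] [Module k D]
variable (p s : D →ₗ[k] D →ₗ[k] D)

/-- The two ways of summing over the triples of natural numbers with sum `n` agree. -/
theorem sum_antidiagonal_assoc {M : Type*} [AddCommMonoid M] (F : ℕ → ℕ → ℕ → M) (n : ℕ) :
    ∑ ij ∈ antidiagonal n, ∑ kl ∈ antidiagonal ij.1, F kl.1 kl.2 ij.2 =
      ∑ ij ∈ antidiagonal n, ∑ kl ∈ antidiagonal ij.2, F ij.1 kl.1 kl.2 := by
  rw [Finset.sum_sigma', Finset.sum_sigma']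
  refine Finset.sum_nbij' (fun x => ⟨(x.2.1, x.2.2 + x.1.2), (x.2.2, x.1.2)⟩)
    (fun x => ⟨(x.1.1 + x.2.1, x.2.2), (x.1.1, x.2.1)⟩) ?_ ?_ ?_ ?_ ?_ <;>
    rintro ⟨⟨i, j⟩, ⟨l, m⟩⟩ h <;> simp at h ⊢ <;> grind

theorem conv_add_left (b : D →ₗ[k] D →ₗ[k] D) (f f' g : ℕ → D) :
    conv b (f + f') g = conv b f g + conv b f' g := by
  funext n
  simp [conv, sum_add_distrib]

theorem conv_add_right (b : D →ₗ[k] D →ₗ[k] D) (f g g' : ℕ → D) :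
    conv b f (g + g') = conv b f g + conv b f g' := by
  funext n
  simp [conv, sum_add_distrib]

theorem conv_add_map (b b' : D →ₗ[k] D →ₗ[k] D) (f g : ℕ → D) :
    conv (b + b') f g = conv b f g + conv b' f g := by
  funext n
  simp [conv, sum_add_distrib]

theorem sconv_add (t : ℕ → k) (f g : ℕ → D) : sconv t (f + g) = sconv t f + sconv t g := by
  funext n
  simp [sconv, sum_add_distrib]

theorem kconv_comm (t u : ℕ → k) : kconv t u = kconv u t := by
  funext n
  simp only [kconv]
  rw [← Finset.Nat.sum_antidiagonal_swap]
  simp [mul_comm]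

theorem conv_conv {b₁ b₂ b₃ b₄ : D →ₗ[k] D →ₗ[k] D}
    (h : ∀ x y z, b₁ (b₂ x y) z = b₃ x (b₄ y z)) (f g e : ℕ → D) :
    conv b₁ (conv b₂ f g) e = conv b₃ f (conv b₄ g e) := by
  funext n
  simp only [conv, map_sum, LinearMap.sum_apply, h]
  exact sum_antidiagonal_assoc (fun i j l => b₃ (f i) (b₄ (g j) (e l))) n

theorem conv_sconv_left (b : D →ₗ[k] D →ₗ[k] D) (t : ℕ → k) (f g : ℕ → D) :
    conv b (sconv t f) g = sconv t (conv b f g) := by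
  funext n
  simp only [conv, sconv, map_sum, LinearMap.sum_apply, map_smul, LinearMap.smul_apply, smul_sum]
  exact sum_antidiagonal_assoc (fun i j l => t i • b (f j) (g l)) n

theorem sconv_eq_flip (t : ℕ → k) (f : ℕ → D) (n : ℕ) :
    sconv t f n = ∑ ij ∈ antidiagonal n, t ij.2 • f ij.1 := by
  rw [sconv, ← Finset.Nat.sum_antidiagonal_swap]
  simp

theorem conv_sconv_right (b : D →ₗ[k] D →ₗ[k] D) (t : ℕ → k) (f g : ℕ → D) :
    conv b f (sconv t g) = sconv t (conv b f g) := by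
  funext n
  simp only [conv, sconv_eq_flip, map_sum, map_smul, smul_sum]
  exact (sum_antidiagonal_assoc (fun i j l => t l • b (f i) (g j)) n).symm

theorem sconv_sconv (t u : ℕ → k) (f : ℕ → D) :
    sconv t (sconv u f) = sconv (kconv t u) f := by
  funext n
  simp only [sconv, kconv, sum_smul, smul_sum, smul_smul]
  exact (sum_antidiagonal_assoc (fun i j l => (t i * u j) • f l) n).symm

theorem precA_precA (ax1 : ∀ a b c : D, p (p a b) c = p a (p b c + s b c)) (x y z : Aug k D) :
    precA p (precA p x y) z = precA p x (starA p s y z) := by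
  have h := conv_conv (b₁ := p) (b₂ := p) (b₃ := p) (b₄ := p + s)
    (fun a b c => by simpa using ax1 a b c) x.2 y.2 z.2
  simp only [precA, starA, conv_add_left, conv_add_right, sconv_add, conv_sconv_left,
    conv_sconv_right, sconv_sconv, h, conv_add_map, kconv_comm z.1 y.1]
  congr 1
  abel

theorem succA_succA (ax3 : ∀ a b c : D, s a (s b c) = s (p a b + s a b) c) (x y z : Aug k D) :
    succA s x (succA s y z) = succA s (starA p s x y) z := by
  have h := conv_conv (b₁ := s) (b₂ := p + s) (b₃ := s) (b₄ := s)
    (fun a b c => by simpa using (ax3 a b c).symm) x.2 y.2 z.2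
  simp only [succA, starA, conv_add_left, conv_add_right, sconv_add, conv_sconv_left,
    conv_sconv_right, sconv_sconv, ← h, conv_add_map]
  congr 1
  abel

theorem sconv_zero_left (f : ℕ → D) : sconv (0 : ℕ → k) f = 0 := by
  funext n
  simp [sconv]

theorem kconv_zero_left (t : ℕ → k) : kconv 0 t = 0 := by
  funext n
  simp [kconv]

theorem conv_zero_left (b : D →ₗ[k] D →ₗ[k] D) (g : ℕ → D) : conv b 0 g = 0 := by
  funext n
  simp [conv]

theorem conv_zero_right (b : D →ₗ[k] D →ₗ[k] D) (f : ℕ → D) : conv b f 0 = 0 := by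
  funext n
  simp [conv]

theorem sconv_one_s7 (f : ℕ → D) : sconv (augOne : Aug k D).1 f = f := by
  funext n
  cases n <;> simp [sconv, augOne, Finset.Nat.sum_antidiagonal_succ]

theorem starA_eq_of_fst_right {x y : Aug k D} (hy : y.1 = 0) :
    starA p s x y = succA s x y + precA p x y := by
  simp only [starA, succA, precA, hy, sconv_zero_left, kconv_comm x.1, kconv_zero_left,
    Prod.mk_add_mk, add_zero]
  congr 1
  abel

theorem starA_eq_of_fst_left {x y : Aug k D} (hx : x.1 = 0) :
    starA p s x y = precA p x y + succA s x y := by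
  simp only [starA, succA, precA, hx, sconv_zero_left, kconv_zero_left,
    Prod.mk_add_mk, add_zero]
  congr 1
  abel

theorem succA_one_left {x : Aug k D} (hx : x.1 = 0) : succA s augOne x = x := by
  refine Prod.ext hx.symm ?_
  have h : (augOne : Aug k D).2 = 0 := rfl
  simp [succA, sconv_one_s7, h, conv_zero_left]

theorem precA_one_right {x : Aug k D} (hx : x.1 = 0) : precA p x augOne = x := by
  refine Prod.ext hx.symm ?_
  have h : (augOne : Aug k D).2 = 0 := rfl
  simp [precA, sconv_one_s7, h, conv_zero_right]

theorem precA_one_add_lam_left (x : Aug k D) {w : Aug k D} (hw : w.1 = 0) :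
    precA p (augOne + lam x) w = lam (precA p x w) := by
  refine Prod.ext ?_ ?_ <;> funext n <;> cases n <;>
    simp [precA, lam, hw, augOne, sconv_zero_left, conv, Finset.Nat.sum_antidiagonal_succ]

theorem succA_one_add_lam_right {w : Aug k D} (hw : w.1 = 0) (x : Aug k D) :
    succA s w (augOne + lam x) = lam (succA s w x) := by
  refine Prod.ext ?_ ?_ <;> funext n <;> cases n <;>
    simp [succA, lam, hw, augOne, sconv_zero_left, conv, Finset.Nat.sum_antidiagonal_succ']

end Convolution

section DendriformAug

variable {k : Type} [Field k] [CharZero k]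
variable {D : Type} [AddCommGroup D] [Module k D]
variable (p s : D →ₗ[k] D →ₗ[k] D)

/-- Let `Ā` be a unital dendriform algebra and `a b c d ∈ A`.  Let `Y` solve
`Y = 1 + λ b ≺ Y` with inverse `Y⁻¹` solving `Y⁻¹ = 1 − λ Y⁻¹ ≻ b`, and `Z` solve
`Z = 1 + λ Z ≻ d` with inverse `Z⁻¹` solving `Z⁻¹ = 1 − λ d ≺ Z⁻¹`.  Then
`E := Y * (Y⁻¹ ≻ a)` solves `E = a + λ b ≺ E` and `F := (c ≺ Z⁻¹) * Z` solves
`F = c + λ F ≻ d`. -/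
theorem dendriform_EF_solutions
    (ax1 : ∀ a b c : D, p (p a b) c = p a (p b c + s b c))
    (ax2 : ∀ a b c : D, p (s a b) c = s a (p b c))
    (ax3 : ∀ a b c : D, s a (s b c) = s (p a b + s a b) c)
    (a b c d : D) (Y Yi Z Zi : Aug k D)
    (hY : Y = augOne + lam (precA p (ofD b) Y))
    (hYi : Yi = augOne - lam (succA s Yi (ofD b)))
    (hYinv : starA p s Y Yi = augOne ∧ starA p s Yi Y = augOne)
    (hZ : Z = augOne + lam (succA s Z (ofD d)))
    (hZi : Zi = augOne - lam (precA p (ofD d) Zi))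
    (hZinv : starA p s Z Zi = augOne ∧ starA p s Zi Z = augOne) :
    starA p s Y (succA s Yi (ofD a)) =
      ofD a + lam (precA p (ofD b) (starA p s Y (succA s Yi (ofD a)))) ∧
    starA p s (precA p (ofD c) Zi) Z =
      ofD c + lam (succA s (starA p s (precA p (ofD c) Zi) Z) (ofD d)) := by
  constructor
  · rw [starA_eq_of_fst_right p s (x := Y) (y := succA s Yi (ofD a)) rfl,
      succA_succA p s ax3, hYinv.1, succA_one_left s rfl]
    conv_lhs => rw [hY, precA_one_add_lam_left p _ rfl, precA_precA p s ax1]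
    rw [starA_eq_of_fst_right p s rfl, succA_succA p s ax3, hYinv.1, succA_one_left s rfl]
  · rw [starA_eq_of_fst_left p s (x := precA p (ofD c) Zi) (y := Z) rfl,
      precA_precA p s ax1, hZinv.2, precA_one_right p rfl]
    conv_lhs =>
      enter [2]
      rw [hZ, succA_one_add_lam_right s rfl, succA_succA p s ax3]
    rw [starA_eq_of_fst_left p s rfl, precA_precA p s ax1, hZinv.2, precA_one_right p rfl]

end DendriformAug
end

section
/- Pre-Lie Fer expansion: let Ā be a unital dendriform algebra and a ∈ A. Define U'_0 := λa and recursively U'_{n+1} := Σ_{l>0} ((−1)^l · l/(l+1)!) L_▷[U'_n]^{(l)}(U'_n) for n ≥ 0, where L_▷[x](y) := x ▷ y := x ≻ y − y ≺ x. Then the ordered infinite products Y = →∏_{n≥0} exp*(U'_n) (factors multiplied left to right in increasing n) and Y⁻¹ = ←∏_{n≥0} exp*(−U'_n) (factors multiplied right to left in increasing n) are the solutions of Y = 1 + λ a ≺ Y and Y⁻¹ = 1 − λ Y⁻¹ ≻ a respectively, in Ā[[λ]]. -/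
open Finset

section DendriformAug

variable {k : Type} [Field k] [CharZero k]
variable {D : Type} [AddCommGroup D] [Module k D]

variable (p s : D →ₗ[k] D →ₗ[k] D)

/-- The left pre-Lie product `x ▷ y := x ≻ y − y ≺ x` on `Ā[[λ]]`. -/
def preLieL (x y : Aug k D) : Aug k D := succA s x y - precA p y x

/-- The right pre-Lie product `x ◁ y := x ≺ y − y ≻ x` on `Ā[[λ]]`. -/
def preLieR (x y : Aug k D) : Aug k D := precA p x y - succA s y x

/-- Iteration `L_▷[x]^{(m)}(y)` of the operator `L_▷[x] : y ↦ x ▷ y`. -/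
def iterL (x : Aug k D) : ℕ → Aug k D → Aug k D
  | 0, y => y
  | m + 1, y => preLieL p s x (iterL x m y)

/-- Iteration `R_◁[x]^{(m)}(y)` of the operator `R_◁[x] : y ↦ y ◁ x`. -/
def iterR (x : Aug k D) : ℕ → Aug k D → Aug k D
  | 0, y => y
  | m + 1, y => preLieR p s (iterR x m y) x

/-- `*`-powers `x^{*n}` in `Ā[[λ]]`. -/
def starPow (x : Aug k D) : ℕ → Aug k D
  | 0 => augOne
  | n + 1 => starA p s (starPow x n) x

/-- The λ-adic sum `Σ_{m ≥ 0} F m` of a family whose `m`-th term has λ-adic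
valuation at least `m`:  the coefficient of `λ^n` is `Σ_{m ≤ n} (F m)_n`. -/
def seriesSum (F : ℕ → Aug k D) : Aug k D :=
  (fun n => ∑ m ∈ range (n + 1), (F m).1 n,
   fun n => ∑ m ∈ range (n + 1), (F m).2 n)

/-- The exponential `exp*(x) := Σ_{n ≥ 0} x^{*n}/n!` for `x ∈ λ Ā[[λ]]`. -/
def expStar (x : Aug k D) : Aug k D :=
  seriesSum (fun m => ((Nat.factorial m : k))⁻¹ • starPow p s x m)

/-- The pre-Lie Fer expansion terms: `U'_0 := λa` and
`U'_{n+1} := Σ_{l>0} ((−1)^l l/(l+1)!) L_▷[U'_n]^{(l)}(U'_n)`. -/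
def ferU (a : D) : ℕ → Aug k D
  | 0 => lam (ofD a)
  | n + 1 => seriesSum (fun l => if l = 0 then 0 else
      ((-1) ^ l * (l : k) / (Nat.factorial (l + 1) : k)) •
        iterL p s (ferU a n) l (ferU a n))

/-- Left-to-right partial products `F 0 * F 1 * ⋯ * F (n-1)`. -/
def prodL (F : ℕ → Aug k D) : ℕ → Aug k D
  | 0 => augOne
  | n + 1 => starA p s (prodL F n) (F n)

/-- Right-to-left partial products `F (n-1) * ⋯ * F 1 * F 0`. -/
def prodR (F : ℕ → Aug k D) : ℕ → Aug k D
  | 0 => augOne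
  | n + 1 => starA p s (F n) (prodR F n)

/-- The λ-adic limit of a sequence of partial products whose `n`-th coefficient
stabilizes from stage `n+1` on. -/
def limitProd (P : ℕ → Aug k D) : Aug k D :=
  (fun n => (P (n + 1)).1 n, fun n => (P (n + 1)).2 n)

set_option linter.unusedSectionVars false

section Convolution

variable {U V W P Q : Type} [AddCommGroup U] [Module k U] [AddCommGroup V] [Module k V]
  [AddCommGroup W] [Module k W] [AddCommGroup P] [Module k P] [AddCommGroup Q] [Module k Q]

/-- Cauchy convolution of two series along an arbitrary bilinear map. -/
def bconv (b : U →ₗ[k] V →ₗ[k] W) (f : ℕ → U) (g : ℕ → V) : ℕ → W :=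
  fun n => ∑ ij ∈ antidiagonal n, b (f ij.1) (g ij.2)

theorem bconv_flip (b : U →ₗ[k] V →ₗ[k] W) (f : ℕ → U) (g : ℕ → V) :
    bconv b.flip g f = bconv b f g := by
  funext n
  unfold bconv
  rw [← Nat.sum_antidiagonal_swap]
  simp

theorem bconv_add_left (b : U →ₗ[k] V →ₗ[k] W) (f f' : ℕ → U) (g : ℕ → V) :
    bconv b (f + f') g = bconv b f g + bconv b f' g := by
  funext n
  simp [bconv, sum_add_distrib]

theorem bconv_add_right (b : U →ₗ[k] V →ₗ[k] W) (f : ℕ → U) (g g' : ℕ → V) :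
    bconv b f (g + g') = bconv b f g + bconv b f g' := by
  funext n
  simp [bconv, sum_add_distrib]

theorem bconv_smul_left (b : U →ₗ[k] V →ₗ[k] W) (c : k) (f : ℕ → U) (g : ℕ → V) :
    bconv b (c • f) g = c • bconv b f g := by
  funext n
  simp [bconv, smul_sum]

theorem bconv_smul_right (b : U →ₗ[k] V →ₗ[k] W) (c : k) (f : ℕ → U) (g : ℕ → V) :
    bconv b f (c • g) = c • bconv b f g := by
  funext n
  simp [bconv, smul_sum]

theorem bconv_assoc (b₁ : P →ₗ[k] V →ₗ[k] Q) (b₂ : U →ₗ[k] W →ₗ[k] P)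
    {P' : Type} [AddCommGroup P'] [Module k P'] (b₃ : U →ₗ[k] P' →ₗ[k] Q)
    (b₄ : W →ₗ[k] V →ₗ[k] P') (h : ∀ u w v, b₁ (b₂ u w) v = b₃ u (b₄ w v))
    (f : ℕ → U) (g : ℕ → W) (l : ℕ → V) :
    bconv b₁ (bconv b₂ f g) l = bconv b₃ f (bconv b₄ g l) := by
  funext n
  simp only [bconv, map_sum, LinearMap.sum_apply, h]
  rw [sum_sigma', sum_sigma']
  refine sum_nbij' (fun x => ⟨(x.2.1, x.2.2 + x.1.2), (x.2.2, x.1.2)⟩)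
    (fun x => ⟨(x.1.1 + x.2.1, x.2.2), (x.1.1, x.2.1)⟩) ?_ ?_ ?_ ?_ ?_
  · rintro ⟨⟨i, j⟩, ⟨u, v⟩⟩ h
    simp only [mem_sigma, HasAntidiagonal.mem_antidiagonal] at h ⊢
    refine ⟨?_, trivial⟩
    omega
  · rintro ⟨⟨i, j⟩, ⟨u, v⟩⟩ h
    simp only [mem_sigma, HasAntidiagonal.mem_antidiagonal] at h ⊢
    refine ⟨?_, trivial⟩
    omega
  · rintro ⟨⟨i, j⟩, ⟨u, v⟩⟩ h
    simp only [mem_sigma, HasAntidiagonal.mem_antidiagonal] at h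
    obtain ⟨-, rfl⟩ := h
    rfl
  · rintro ⟨⟨i, j⟩, ⟨u, v⟩⟩ h
    simp only [mem_sigma, HasAntidiagonal.mem_antidiagonal] at h
    obtain ⟨-, rfl⟩ := h
    rfl
  · intros
    rfl

/-- The coefficients of `f` below degree `N` vanish. -/
def VanishBelow (N : ℕ) (f : ℕ → U) : Prop := ∀ i < N, f i = 0

theorem VanishBelow.mono {N N' : ℕ} {f : ℕ → U} (h : VanishBelow N f) (hN : N' ≤ N) :
    VanishBelow N' f :=
  fun i hi => h i (hi.trans_le hN)

theorem VanishBelow.bconv {M N : ℕ} (b : U →ₗ[k] V →ₗ[k] W) {f : ℕ → U} {g : ℕ → V}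
    (hf : VanishBelow M f) (hg : VanishBelow N g) : VanishBelow (M + N) (bconv b f g) := by
  intro n hn
  refine sum_eq_zero fun ij h => ?_
  rw [HasAntidiagonal.mem_antidiagonal] at h
  rcases lt_or_ge ij.1 M with h' | h'
  · simp [hf _ h']
  · simp [hg ij.2 (by omega)]

/-- Convolution distributes over the sum of a family of increasing valuation. -/
theorem bconv_series_left (b : U →ₗ[k] V →ₗ[k] W) (F : ℕ → ℕ → U)
    (hF : ∀ m, VanishBelow m (F m)) (g : ℕ → V) (n : ℕ) :
    bconv b (fun i => ∑ m ∈ range (i + 1), F m i) g n =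
      ∑ m ∈ range (n + 1), bconv b (F m) g n := by
  simp only [bconv]
  rw [sum_comm]
  refine sum_congr rfl fun ij h => ?_
  rw [HasAntidiagonal.mem_antidiagonal] at h
  rw [← LinearMap.sum_apply, ← map_sum]
  congr 2
  refine sum_subset (range_mono (by omega)) fun m _ hm => hF m _ ?_
  simpa using hm

end Convolution

/-- The left action of `Ā[[λ]]` on `D[[λ]]`, given by `≻`. -/
def leftAct (s : D →ₗ[k] D →ₗ[k] D) (x : Aug k D) : Module.End k (ℕ → D) where
  toFun f := conv s x.2 f + sconv x.1 f
  map_add' f g := by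
    change bconv s _ _ + bconv (LinearMap.lsmul k D) _ _ =
      bconv s _ _ + bconv (LinearMap.lsmul k D) _ _ +
        (bconv s _ _ + bconv (LinearMap.lsmul k D) _ _)
    simp only [bconv_add_right]
    abel
  map_smul' c f := by
    change bconv s _ _ + bconv (LinearMap.lsmul k D) _ _ =
      c • (bconv s _ _ + bconv (LinearMap.lsmul k D) _ _)
    simp only [bconv_smul_right, smul_add]

/-- The right action of `Ā[[λ]]` on `D[[λ]]`, given by `≺`. -/
def rightAct (p : D →ₗ[k] D →ₗ[k] D) (x : Aug k D) : Module.End k (ℕ → D) :=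
  leftAct p.flip x

theorem leftAct_apply (x : Aug k D) (f : ℕ → D) :
    leftAct s x f = bconv s x.2 f + bconv (LinearMap.lsmul k D) x.1 f := rfl

theorem rightAct_apply (x : Aug k D) (f : ℕ → D) :
    rightAct p x f = bconv p f x.2 + bconv (LinearMap.lsmul k D) x.1 f := by
  rw [rightAct, leftAct_apply, bconv_flip]

theorem starA_snd (x y : Aug k D) :
    (starA p s x y).2 = leftAct s x y.2 + rightAct p y x.2 := by
  rw [leftAct_apply, rightAct_apply]
  change bconv p _ _ + bconv s _ _ + bconv (LinearMap.lsmul k D) _ _ +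
    bconv (LinearMap.lsmul k D) _ _ = _
  abel

theorem preLieL_eq (x y : Aug k D) :
    preLieL p s x y = (0, (leftAct s x - rightAct p x) y.2) := by
  rw [LinearMap.sub_apply, leftAct_apply, rightAct_apply]
  refine Prod.ext (sub_self _) ?_
  rfl

theorem leftAct_starA (ax3 : ∀ a b c : D, s a (s b c) = s (p a b + s a b) c) (x y : Aug k D) :
    leftAct s (starA p s x y) = leftAct s x * leftAct s y := by
  refine LinearMap.ext fun f => ?_
  have h₁ := bconv_assoc s (p + s) s s (fun u w v => by simp [ax3]) x.2 y.2 f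
  have h₂ := bconv_assoc s (LinearMap.lsmul k D) (LinearMap.lsmul k D) s (fun u w v => by simp)
    x.1 y.2 f
  have h₃ := bconv_assoc s (LinearMap.lsmul k D).flip s (LinearMap.lsmul k D)
    (fun u w v => by simp) x.2 y.1 f
  have h₄ := bconv_assoc (LinearMap.lsmul k D) (LinearMap.mul k k) (LinearMap.lsmul k D)
    (LinearMap.lsmul k D) (fun u w v => mul_smul u w v) x.1 y.1 f
  have h₅ : bconv (p + s) x.2 y.2 = bconv p x.2 y.2 + bconv s x.2 y.2 := by
    funext n
    simp [bconv, sum_add_distrib]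
  rw [bconv_flip] at h₃
  rw [h₅] at h₁
  rw [Module.End.mul_apply]
  simp only [leftAct_apply, bconv_add_right, ← h₁, ← h₂, ← h₃, ← h₄, bconv_add_left]
  change bconv s (bconv p _ _ + bconv s _ _ + bconv (LinearMap.lsmul k D) _ _ +
    bconv (LinearMap.lsmul k D) _ _) _ +
    bconv (LinearMap.lsmul k D) (bconv (LinearMap.mul k k) _ _) _ = _
  simp only [bconv_add_left]
  abel

/-- The product of the opposite dendriform algebra. -/
theorem starA_flip (x y : Aug k D) : starA s.flip p.flip x y = starA p s y x := by
  refine Prod.ext ?_ ?_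
  · funext n
    change (∑ ij ∈ antidiagonal n, _) = ∑ ij ∈ antidiagonal n, _
    rw [← Nat.sum_antidiagonal_swap]
    simp [mul_comm]
  · change bconv s.flip _ _ + bconv p.flip _ _ + _ + _ = bconv p _ _ + bconv s _ _ + _ + _
    rw [bconv_flip, bconv_flip]
    abel

theorem rightAct_starA (ax1 : ∀ a b c : D, p (p a b) c = p a (p b c + s b c)) (x y : Aug k D) :
    rightAct p (starA p s x y) = rightAct p y * rightAct p x := by
  rw [← starA_flip, rightAct, leftAct_starA s.flip p.flip (fun a b c => by simp [ax1, add_comm])]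
  rfl

theorem commute_leftAct_rightAct (ax2 : ∀ a b c : D, p (s a b) c = s a (p b c))
    (x y : Aug k D) : Commute (leftAct s x) (rightAct p y) := by
  refine LinearMap.ext fun f => ?_
  have h₁ := bconv_assoc p s s p (fun u w v => by simp [ax2]) x.2 f y.2
  have h₂ := bconv_assoc p (LinearMap.lsmul k D) (LinearMap.lsmul k D) p (fun u w v => by simp)
    x.1 f y.2
  have h₃ := bconv_assoc (LinearMap.lsmul k D).flip s s (LinearMap.lsmul k D).flip
    (fun u w v => by simp) x.2 f y.1
  have h₄ := bconv_assoc (LinearMap.lsmul k D).flip (LinearMap.lsmul k D) (LinearMap.lsmul k D)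
    (LinearMap.lsmul k D).flip (fun u w v => smul_comm v u w) x.1 f y.1
  simp only [bconv_flip] at h₃ h₄
  rw [Module.End.mul_apply, Module.End.mul_apply]
  simp only [leftAct_apply, rightAct_apply, bconv_add_right, bconv_add_left, h₁, h₂, h₃, h₄]
  abel

section ExponentialIdentities

variable {S : Type} [Ring S] [Algebra k S]

theorem sum_exp_mul_exp {x y : S} (h : Commute x y) (q : ℕ) :
    ∑ ij ∈ antidiagonal q, ((ij.1.factorial : k)⁻¹ * (ij.2.factorial : k)⁻¹) •
      (x ^ ij.1 * y ^ ij.2) = (q.factorial : k)⁻¹ • (x + y) ^ q := by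
  rw [h.add_pow', smul_sum]
  refine sum_congr rfl fun ij hij => ?_
  rw [HasAntidiagonal.mem_antidiagonal] at hij
  rw [← Nat.cast_smul_eq_nsmul k, smul_smul, ← hij, Nat.cast_add_choose]
  congr 1
  have := Nat.factorial_ne_zero (ij.1 + ij.2)
  field_simp

theorem sum_exp_mul_integrated_exp {x y : S} (h : Commute x y) (q : ℕ) :
    ∑ ij ∈ antidiagonal q, ((ij.1.factorial : k)⁻¹ * ((ij.2 + 1).factorial : k)⁻¹) •
      (x ^ ij.1 * y ^ ij.2) =
    ((q + 1).factorial : k)⁻¹ • ∑ ij ∈ antidiagonal q, x ^ ij.1 * (x + y) ^ ij.2 := by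
  induction q with
  | zero => simp
  | succ q ih =>
    have hq : ((q + 2 : ℕ) : k) ≠ 0 := Nat.cast_ne_zero.2 (by omega)
    have key : ((q + 2 : ℕ) : k) • ∑ ij ∈ antidiagonal (q + 1),
        ((ij.1.factorial : k)⁻¹ * ((ij.2 + 1).factorial : k)⁻¹) • (x ^ ij.1 * y ^ ij.2) =
        x * (∑ ij ∈ antidiagonal q,
          ((ij.1.factorial : k)⁻¹ * ((ij.2 + 1).factorial : k)⁻¹) • (x ^ ij.1 * y ^ ij.2)) +
        ((q + 1).factorial : k)⁻¹ • (x + y) ^ (q + 1) := by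
      have h₁ : x * (∑ ij ∈ antidiagonal q,
          ((ij.1.factorial : k)⁻¹ * ((ij.2 + 1).factorial : k)⁻¹) • (x ^ ij.1 * y ^ ij.2)) =
          ∑ ij ∈ antidiagonal (q + 1), ((ij.1 : k) *
            ((ij.1.factorial : k)⁻¹ * ((ij.2 + 1).factorial : k)⁻¹)) •
              (x ^ ij.1 * y ^ ij.2) := by
        rw [Nat.sum_antidiagonal_succ, mul_sum]
        simp only [Nat.cast_zero, zero_mul, zero_smul, zero_add]
        refine sum_congr rfl fun ij _ => ?_
        rw [mul_smul_comm, ← mul_assoc, ← pow_succ']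
        congr 1
        have : ((ij.1 + 1 : ℕ) : k) ≠ 0 := Nat.cast_ne_zero.2 (by omega)
        rw [Nat.factorial_succ ij.1, Nat.cast_mul]
        field_simp
      rw [h₁, ← sum_exp_mul_exp h, smul_sum, ← sum_add_distrib]
      refine sum_congr rfl fun ij hij => ?_
      rw [HasAntidiagonal.mem_antidiagonal] at hij
      rw [smul_smul, ← add_smul]
      congr 1
      have h₂ : ((q + 2 : ℕ) : k) = (ij.1 : k) + ((ij.2 + 1 : ℕ) : k) := by
        rw [← Nat.cast_add]
        congr 1
        omega
      have : ((ij.2 + 1 : ℕ) : k) ≠ 0 := Nat.cast_ne_zero.2 (by omega)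
      rw [h₂, Nat.factorial_succ ij.2, Nat.cast_mul]
      field_simp
    rw [← inv_smul_smul₀ hq (∑ ij ∈ antidiagonal (q + 1), _), key, ih,
      Nat.sum_antidiagonal_succ (n := q) (f := fun ij => x ^ ij.1 * (x + y) ^ ij.2),
      Nat.factorial_succ (q + 1), Nat.cast_mul, mul_inv, mul_smul, mul_smul_comm, mul_sum,
      ← smul_add]
    simp only [pow_zero, one_mul, pow_succ', mul_assoc]
    rw [add_comm (∑ ij ∈ antidiagonal q, _)]

/-- The component of degree `q` in `x`, `y` of the identity
`e^x · ∑ₗ (-1)ˡ l / (l+1)! (x - y)ˡ = e^y - (e^x - e^y) / (x - y)`. -/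
theorem sum_exp_mul_fer {x y : S} (h : Commute x y) (q : ℕ) :
    ∑ ij ∈ antidiagonal q, ((ij.1.factorial : k)⁻¹ *
      ((-1) ^ ij.2 * (ij.2 : k) / ((ij.2 + 1).factorial : k))) • (x ^ ij.1 * (x - y) ^ ij.2) =
    (q.factorial : k)⁻¹ • y ^ q -
      ((q + 1).factorial : k)⁻¹ • ∑ ij ∈ antidiagonal q, x ^ ij.1 * y ^ ij.2 := by
  have hc : Commute x (y - x) := h.sub_right (Commute.refl x)
  have h₁ := sum_exp_mul_exp (k := k) hc q
  have h₂ := sum_exp_mul_integrated_exp (k := k) hc q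
  rw [add_sub_cancel] at h₁ h₂
  rw [← h₁, ← h₂, ← sum_sub_distrib]
  refine sum_congr rfl fun ij _ => ?_
  have h₃ : (y - x) ^ ij.2 = ((-1 : k) ^ ij.2) • (x - y) ^ ij.2 := by
    rw [← smul_pow, neg_one_smul, neg_sub]
  rw [← sub_smul, h₃, mul_smul_comm, smul_smul]
  congr 1
  have : ((ij.2 + 1 : ℕ) : k) ≠ 0 := Nat.cast_ne_zero.2 (by omega)
  have h₄ : (ij.2 : k) = ((ij.2 + 1 : ℕ) : k) - 1 := by simp
  rw [h₄, Nat.factorial_succ ij.2, Nat.cast_mul]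
  field_simp

end ExponentialIdentities

section Filtration

theorem VanishBelow.add {N : ℕ} {f g : ℕ → D} (hf : VanishBelow N f) (hg : VanishBelow N g) :
    VanishBelow N (f + g) := fun i hi => by simp [hf i hi, hg i hi]

theorem VanishBelow.neg {N : ℕ} {f : ℕ → D} (hf : VanishBelow N f) : VanishBelow N (-f) :=
  fun i hi => by simp [hf i hi]

theorem VanishBelow.sub {N : ℕ} {f g : ℕ → D} (hf : VanishBelow N f) (hg : VanishBelow N g) :
    VanishBelow N (f - g) := fun i hi => by simp [hf i hi, hg i hi]

/-- `T` raises the λ-adic valuation by at least `M`. -/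
def Raises (M : ℕ) (T : Module.End k (ℕ → D)) : Prop :=
  ∀ N f, VanishBelow N f → VanishBelow (M + N) (T f)

theorem Raises.pow {M : ℕ} {T : Module.End k (ℕ → D)} (hT : Raises M T) (i : ℕ) :
    Raises (M * i) (T ^ i) := by
  induction i with
  | zero => intro N f hf; simpa using hf
  | succ i ih =>
    intro N f hf
    rw [pow_succ', Module.End.mul_apply]
    exact (hT _ _ (ih N f hf)).mono (by rw [mul_add]; omega)

theorem Raises.sub {M : ℕ} {T T' : Module.End k (ℕ → D)} (hT : Raises M T) (hT' : Raises M T') :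
    Raises M (T - T') :=
  fun N f hf => (hT N f hf).sub (hT' N f hf)

theorem raises_leftAct {M : ℕ} (x : Aug k D) (h₁ : VanishBelow M x.1) (h₂ : VanishBelow M x.2) :
    Raises M (leftAct s x) := by
  intro N f hf
  rw [leftAct_apply]
  exact (h₂.bconv s hf).add (h₁.bconv (LinearMap.lsmul k D) hf)

theorem raises_rightAct {M : ℕ} (x : Aug k D) (h₁ : VanishBelow M x.1)
    (h₂ : VanishBelow M x.2) : Raises M (rightAct p x) :=
  raises_leftAct p.flip x h₁ h₂

/-- The Fer recursion for a pair of commuting operators raising the valuation, where `T` acts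
as the exponential of `L`. -/
theorem exp_apply_ferSum {L R T : Module.End k (ℕ → D)} (hLR : Commute L R) (hL : Raises 1 L)
    (hR : Raises 1 R)
    (hT : ∀ f n, T f n = ∑ i ∈ range (n + 1), (i.factorial : k)⁻¹ • (L ^ i) f n)
    {m B : ℕ → D}
    (hB : ∀ n, B n = ∑ l ∈ range (n + 1),
      ((-1) ^ l * (l : k) / ((l + 1).factorial : k)) • ((L - R) ^ l) m n) (n : ℕ) :
    T B n = ∑ q ∈ range (n + 1), (q.factorial : k)⁻¹ • (R ^ q) m n -
      ∑ q ∈ range (n + 1), ((q + 1).factorial : k)⁻¹ •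
        (∑ ij ∈ antidiagonal q, L ^ ij.1 * R ^ ij.2) m n := by
  set c : ℕ → k := fun l => (-1) ^ l * (l : k) / ((l + 1).factorial : k) with hc
  have hpow : ∀ l, VanishBelow l (((L - R) ^ l) m) := fun l => by
    simpa using (hL.sub hR).pow l 0 m (fun i hi => absurd hi (by omega))
  have htrunc : ∀ i ∈ range (n + 1), (L ^ i) B n =
      ∑ l ∈ range (n + 1 - i), c l • (L ^ i * (L - R) ^ l) m n := by
    intro i hi
    have hvan : VanishBelow (n + 1 - i)
        (B - ∑ l ∈ range (n + 1 - i), c l • ((L - R) ^ l) m) := by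
      intro j hj
      rw [Pi.sub_apply, hB, sub_eq_zero, Finset.sum_apply]
      refine sum_subset (range_mono (by omega)) fun l _ hl => ?_
      rw [hpow l j (by simpa using hl), smul_zero]
    have := hL.pow i _ _ hvan n (by rw [mem_range] at hi; omega)
    rw [map_sub, Pi.sub_apply, sub_eq_zero] at this
    rw [this, map_sum, Finset.sum_apply]
    simp [Module.End.mul_apply]
  rw [hT, ← sum_sub_distrib]
  calc ∑ i ∈ range (n + 1), (i.factorial : k)⁻¹ • (L ^ i) B n
      = ∑ i ∈ range (n + 1), ∑ l ∈ range (n + 1 - i),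
          ((i.factorial : k)⁻¹ * c l) • (L ^ i * (L - R) ^ l) m n := by
        refine sum_congr rfl fun i hi => ?_
        rw [htrunc i hi, smul_sum]
        simp only [smul_smul]
    _ = ∑ q ∈ range (n + 1), ∑ ij ∈ antidiagonal q,
          ((ij.1.factorial : k)⁻¹ * c ij.2) • (L ^ ij.1 * (L - R) ^ ij.2) m n := by
        rw [← sum_range_diag_flip (n + 1) fun i l =>
          ((i.factorial : k)⁻¹ * c l) • (L ^ i * (L - R) ^ l) m n]
        refine sum_congr rfl fun q _ => ?_
        rw [Nat.sum_antidiagonal_eq_sum_range_succ fun i l =>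
          ((i.factorial : k)⁻¹ * c l) • (L ^ i * (L - R) ^ l) m n]
    _ = _ := by
        refine sum_congr rfl fun q _ => ?_
        have := congrFun (LinearMap.congr_fun (sum_exp_mul_fer (k := k) hLR q) m) n
        simpa only [LinearMap.sum_apply, Finset.sum_apply, LinearMap.smul_apply, Pi.smul_apply,
          LinearMap.sub_apply, Pi.sub_apply] using this

end Filtration

section SeriesSum

/-- The coordinates of `x` vanish below degree `N`. -/
def AugVanish (N : ℕ) (x : Aug k D) : Prop := VanishBelow N x.1 ∧ VanishBelow N x.2

theorem leftAct_smul (c : k) (x : Aug k D) : leftAct s (c • x) = c • leftAct s x := by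
  refine LinearMap.ext fun f => ?_
  rw [LinearMap.smul_apply, leftAct_apply, leftAct_apply, smul_add, ← bconv_smul_left,
    ← bconv_smul_left]
  rfl

theorem leftAct_neg (x : Aug k D) : leftAct s (-x) = -leftAct s x := by
  have h := leftAct_smul s (-1 : k) x
  rw [neg_one_smul] at h
  refine h.trans (LinearMap.ext fun f => ?_)
  rw [LinearMap.smul_apply, LinearMap.neg_apply, neg_one_smul]

theorem rightAct_neg (x : Aug k D) : rightAct p (-x) = -rightAct p x := leftAct_neg _ x

theorem leftAct_seriesSum {F : ℕ → Aug k D} (hF : ∀ m, AugVanish m (F m)) (f : ℕ → D) (n : ℕ) :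
    leftAct s (seriesSum F) f n = ∑ m ∈ range (n + 1), leftAct s (F m) f n := by
  simp only [leftAct_apply, Pi.add_apply, sum_add_distrib]
  rw [← bconv_series_left s (fun m => (F m).2) (fun m => (hF m).2),
    ← bconv_series_left (LinearMap.lsmul k D) (fun m => (F m).1) (fun m => (hF m).1)]
  rfl

theorem bconv_augOne {V W : Type} [AddCommGroup V] [Module k V] [AddCommGroup W] [Module k W]
    (b : k →ₗ[k] V →ₗ[k] W) (f : ℕ → V) :
    bconv b (augOne : Aug k D).1 f = fun n => b 1 (f n) := by
  funext n
  rw [bconv, sum_eq_single (0, n)]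
  · simp [augOne]
  · rintro ⟨i, j⟩ h hne
    rw [HasAntidiagonal.mem_antidiagonal] at h
    have : i ≠ 0 := by
      rintro rfl
      exact hne (by rw [← h, zero_add])
    simp [augOne, this]
  · intro h
    simp at h

theorem leftAct_augOne : leftAct s (augOne : Aug k D) = 1 := by
  refine LinearMap.ext fun f => ?_
  rw [leftAct_apply, bconv_augOne]
  funext n
  simp [bconv, augOne]

theorem rightAct_augOne : rightAct p (augOne : Aug k D) = 1 := leftAct_augOne _

end SeriesSum

section Exponential

variable {p s}

theorem augVanish_starPow {x : Aug k D} (hx : AugVanish 1 x) (m : ℕ) :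
    AugVanish m (starPow p s x m) := by
  induction m with
  | zero => exact ⟨fun i hi => absurd hi (by omega), fun i hi => absurd hi (by omega)⟩
  | succ m ih =>
    refine ⟨ih.1.bconv (LinearMap.mul k k) hx.1, ?_⟩
    rw [starPow, starA_snd]
    exact (raises_leftAct s _ ih.1 ih.2 _ _ hx.2).add
      ((raises_rightAct p _ hx.1 hx.2 _ _ ih.2).mono (by omega))

theorem augVanish_smul_starPow {x : Aug k D} (hx : AugVanish 1 x) (m : ℕ) :
    AugVanish m ((m.factorial : k)⁻¹ • starPow p s x m) :=
  ⟨fun i hi => by simp [(augVanish_starPow (p := p) (s := s) hx m).1 i hi],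
    fun i hi => by simp [(augVanish_starPow (p := p) (s := s) hx m).2 i hi]⟩

theorem leftAct_starPow (ax3 : ∀ a b c : D, s a (s b c) = s (p a b + s a b) c) (x : Aug k D)
    (m : ℕ) : leftAct s (starPow p s x m) = leftAct s x ^ m := by
  induction m with
  | zero => exact leftAct_augOne s
  | succ m ih => rw [starPow, leftAct_starA p s ax3, ih, pow_succ]

theorem rightAct_starPow (ax1 : ∀ a b c : D, p (p a b) c = p a (p b c + s b c)) (x : Aug k D)
    (m : ℕ) : rightAct p (starPow p s x m) = rightAct p x ^ m := by
  induction m with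
  | zero => exact rightAct_augOne p
  | succ m ih => rw [starPow, rightAct_starA p s ax1, ih, pow_succ']

theorem leftAct_expStar (ax3 : ∀ a b c : D, s a (s b c) = s (p a b + s a b) c) {x : Aug k D}
    (hx : AugVanish 1 x) (f : ℕ → D) (n : ℕ) :
    leftAct s (expStar p s x) f n =
      ∑ i ∈ range (n + 1), (i.factorial : k)⁻¹ • (leftAct s x ^ i) f n := by
  rw [expStar, leftAct_seriesSum s (augVanish_smul_starPow hx)]
  simp only [leftAct_smul, leftAct_starPow ax3]
  rfl

theorem rightAct_expStar (ax1 : ∀ a b c : D, p (p a b) c = p a (p b c + s b c)) {x : Aug k D}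
    (hx : AugVanish 1 x) (f : ℕ → D) (n : ℕ) :
    rightAct p (expStar p s x) f n =
      ∑ i ∈ range (n + 1), (i.factorial : k)⁻¹ • (rightAct p x ^ i) f n := by
  rw [expStar, rightAct, leftAct_seriesSum p.flip (augVanish_smul_starPow hx)]
  simp only [leftAct_smul]
  change ∑ m ∈ range (n + 1), ((m.factorial : k)⁻¹ • rightAct p (starPow p s x m)) f n = _
  simp only [rightAct_starPow ax1]
  rfl

theorem starPow_succ_snd (ax3 : ∀ a b c : D, s a (s b c) = s (p a b + s a b) c) (x : Aug k D)
    (hLR : Commute (leftAct s x) (rightAct p x)) (q : ℕ) :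
    (starPow p s x (q + 1)).2 =
      (∑ ij ∈ antidiagonal q, leftAct s x ^ ij.1 * rightAct p x ^ ij.2) x.2 := by
  induction q with
  | zero =>
    rw [starPow, starPow, starA_snd, leftAct_augOne]
    simp [augOne]
  | succ q ih =>
    rw [starPow, starA_snd, ih, leftAct_starPow ax3, Nat.sum_antidiagonal_succ',
      ← Module.End.mul_apply, mul_sum, LinearMap.add_apply]
    simp only [pow_zero, mul_one, pow_succ' (rightAct p x), ← mul_assoc,
      (hLR.pow_left _).eq]

theorem expStar_snd (ax3 : ∀ a b c : D, s a (s b c) = s (p a b + s a b) c) {x : Aug k D}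
    (hx : AugVanish 1 x) (hLR : Commute (leftAct s x) (rightAct p x)) (n : ℕ) :
    (expStar p s x).2 n = ∑ q ∈ range (n + 1), ((q + 1).factorial : k)⁻¹ •
      (∑ ij ∈ antidiagonal q, leftAct s x ^ ij.1 * rightAct p x ^ ij.2) x.2 n := by
  simp only [← starPow_succ_snd ax3 x hLR]
  have h := sum_range_succ' (fun m => ((m.factorial : k)⁻¹ • starPow p s x m).2 n) (n + 1)
  rw [sum_range_succ, (augVanish_smul_starPow hx (n + 1)).2 n (by omega), add_zero] at h
  refine h.trans ?_
  simp [starPow, augOne]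

theorem expStar_fst {x : Aug k D} (hx : x.1 = 0) : (expStar p s x).1 = (augOne : Aug k D).1 := by
  funext n
  change ∑ m ∈ range (n + 1), ((m.factorial : k)⁻¹ • starPow p s x m).1 n = _
  rw [sum_range_succ', sum_eq_zero, zero_add]
  · simp [starPow]
  · intro m _
    change (_ : k) • bconv (LinearMap.mul k k) (starPow p s x m).1 x.1 n = 0
    simp [bconv, hx]

end Exponential

section Fer

variable {p s}

theorem iterL_fst {x y : Aug k D} (hy : y.1 = 0) (l : ℕ) : (iterL p s x l y).1 = 0 := by
  cases l with
  | zero => exact hy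
  | succ l => rw [iterL, preLieL_eq]

theorem iterL_snd (x y : Aug k D) (l : ℕ) :
    (iterL p s x l y).2 = ((leftAct s x - rightAct p x) ^ l) y.2 := by
  induction l with
  | zero => rfl
  | succ l ih => rw [iterL, preLieL_eq, pow_succ', Module.End.mul_apply, ih]

theorem ferU_fst (a : D) (n : ℕ) : (ferU p s a n).1 = 0 := by
  induction n with
  | zero => funext i; cases i <;> rfl
  | succ n ih =>
    funext i
    change ∑ l ∈ range (i + 1), (ite _ _ _ : Aug k D).1 i = 0
    refine sum_eq_zero fun l _ => ?_
    split_ifs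
    · rfl
    · simp [iterL_fst ih]

theorem ferU_succ_snd (a : D) (n i : ℕ) :
    (ferU p s a (n + 1)).2 i = ∑ l ∈ range (i + 1),
      ((-1) ^ l * (l : k) / ((l + 1).factorial : k)) •
        ((leftAct s (ferU p s a n) - rightAct p (ferU p s a n)) ^ l) (ferU p s a n).2 i := by
  change ∑ l ∈ range (i + 1), (ite _ _ _ : Aug k D).2 i = _
  refine sum_congr rfl fun l _ => ?_
  split_ifs with h
  · simp [h]
  · rw [← iterL_snd]
    rfl

theorem vanishBelow_ferU (a : D) (n : ℕ) : VanishBelow (n + 1) (ferU p s a n).2 := by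
  induction n with
  | zero =>
    intro i hi
    obtain rfl : i = 0 := by omega
    rfl
  | succ n ih =>
    intro i hi
    rw [ferU_succ_snd]
    refine sum_eq_zero fun l _ => ?_
    rcases Nat.eq_zero_or_pos l with rfl | hl
    · simp
    · have h₀ : VanishBelow (n + 1) (ferU p s a n).1 := fun i _ => by rw [ferU_fst]; rfl
      have h₁ := ((raises_leftAct s _ h₀ ih).sub (raises_rightAct p _ h₀ ih)).pow l _ _ ih
      rw [h₁ i (by nlinarith), smul_zero]

theorem augVanish_ferU (a : D) (n : ℕ) : AugVanish 1 (ferU p s a n) :=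
  ⟨fun i _ => by rw [ferU_fst]; rfl, (vanishBelow_ferU a n).mono (by omega)⟩

theorem AugVanish.neg {N : ℕ} {x : Aug k D} (hx : AugVanish N x) : AugVanish N (-x) :=
  ⟨fun i hi => by simp [hx.1 i hi], hx.2.neg⟩

theorem leftAct_expStar_ferU (ax1 : ∀ a b c : D, p (p a b) c = p a (p b c + s b c))
    (ax2 : ∀ a b c : D, p (s a b) c = s a (p b c))
    (ax3 : ∀ a b c : D, s a (s b c) = s (p a b + s a b) c) (a : D) (n : ℕ) :
    leftAct s (expStar p s (ferU p s a n)) (ferU p s a (n + 1)).2 =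
      rightAct p (expStar p s (ferU p s a n)) (ferU p s a n).2 -
        (expStar p s (ferU p s a n)).2 := by
  have hx := augVanish_ferU (p := p) (s := s) a n
  have hLR := commute_leftAct_rightAct p s ax2 (ferU p s a n) (ferU p s a n)
  funext i
  rw [Pi.sub_apply, rightAct_expStar ax1 hx, expStar_snd ax3 hx hLR]
  exact exp_apply_ferSum hLR (raises_leftAct s _ hx.1 hx.2) (raises_rightAct p _ hx.1 hx.2)
    (leftAct_expStar ax3 hx) (ferU_succ_snd a n) i

theorem rightAct_expStar_neg_ferU (ax1 : ∀ a b c : D, p (p a b) c = p a (p b c + s b c))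
    (ax2 : ∀ a b c : D, p (s a b) c = s a (p b c))
    (ax3 : ∀ a b c : D, s a (s b c) = s (p a b + s a b) c) (a : D) (n : ℕ) :
    rightAct p (expStar p s (-ferU p s a n)) (ferU p s a (n + 1)).2 =
      leftAct s (expStar p s (-ferU p s a n)) (ferU p s a n).2 +
        (expStar p s (-ferU p s a n)).2 := by
  have hx := (augVanish_ferU (p := p) (s := s) a n).neg
  have hLR := commute_leftAct_rightAct p s ax2 (-ferU p s a n) (-ferU p s a n)
  have hB : ∀ i, (-(ferU p s a (n + 1)).2) i = ∑ l ∈ range (i + 1),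
      ((-1) ^ l * (l : k) / ((l + 1).factorial : k)) •
        ((rightAct p (-ferU p s a n) - leftAct s (-ferU p s a n)) ^ l)
          (-ferU p s a n).2 i := by
    intro i
    rw [Pi.neg_apply, ferU_succ_snd, leftAct_neg, rightAct_neg, neg_sub_neg, ← sum_neg_distrib]
    refine sum_congr rfl fun l _ => ?_
    rw [Prod.snd_neg, map_neg, Pi.neg_apply, smul_neg]
  have key := exp_apply_ferSum hLR.symm (raises_rightAct p _ hx.1 hx.2)
    (raises_leftAct s _ hx.1 hx.2) (rightAct_expStar ax1 hx) hB
  have hswap : ∀ q, ∑ ij ∈ antidiagonal q,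
      rightAct p (-ferU p s a n) ^ ij.1 * leftAct s (-ferU p s a n) ^ ij.2 =
      ∑ ij ∈ antidiagonal q,
        leftAct s (-ferU p s a n) ^ ij.1 * rightAct p (-ferU p s a n) ^ ij.2 := by
    intro q
    rw [← Nat.sum_antidiagonal_swap]
    exact sum_congr rfl fun ij _ => (hLR.symm.pow_pow _ _).eq
  have h : rightAct p (expStar p s (-ferU p s a n)) (-(ferU p s a (n + 1)).2) =
      leftAct s (expStar p s (-ferU p s a n)) (-ferU p s a n).2 -
        (expStar p s (-ferU p s a n)).2 := by
    funext i
    rw [Pi.sub_apply, leftAct_expStar ax3 hx, expStar_snd ax3 hx hLR, key]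
    simp only [hswap]
  rw [map_neg, Prod.snd_neg, map_neg] at h
  rw [← neg_inj, h]
  abel

theorem prodL_expStar_snd (ax1 : ∀ a b c : D, p (p a b) c = p a (p b c + s b c))
    (ax2 : ∀ a b c : D, p (s a b) c = s a (p b c))
    (ax3 : ∀ a b c : D, s a (s b c) = s (p a b + s a b) c) (a : D) (N : ℕ) :
    (prodL p s (fun n => expStar p s (ferU p s a n)) N).2 =
      rightAct p (prodL p s (fun n => expStar p s (ferU p s a n)) N) (lam (ofD a) : Aug k D).2 -
        leftAct s (prodL p s (fun n => expStar p s (ferU p s a n)) N) (ferU p s a N).2 := by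
  induction N with
  | zero =>
    rw [prodL, rightAct_augOne, leftAct_augOne]
    exact (sub_self (lam (ofD a) : Aug k D).2).symm
  | succ N ih =>
    have h := leftAct_expStar_ferU ax1 ax2 ax3 a N
    rw [prodL, starA_snd, leftAct_starA p s ax3, rightAct_starA p s ax1, Module.End.mul_apply,
      Module.End.mul_apply, h]
    conv_lhs => rw [ih]
    have hc := LinearMap.congr_fun (commute_leftAct_rightAct p s ax2
      (prodL p s (fun n => expStar p s (ferU p s a n)) N) (expStar p s (ferU p s a N))).eq
      (ferU p s a N).2
    rw [Module.End.mul_apply, Module.End.mul_apply] at hc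
    rw [map_sub, map_sub, hc]
    abel

theorem prodR_expStar_snd (ax1 : ∀ a b c : D, p (p a b) c = p a (p b c + s b c))
    (ax2 : ∀ a b c : D, p (s a b) c = s a (p b c))
    (ax3 : ∀ a b c : D, s a (s b c) = s (p a b + s a b) c) (a : D) (N : ℕ) :
    (prodR p s (fun n => expStar p s (-ferU p s a n)) N).2 =
      rightAct p (prodR p s (fun n => expStar p s (-ferU p s a n)) N) (ferU p s a N).2 -
      leftAct s (prodR p s (fun n => expStar p s (-ferU p s a n)) N) (lam (ofD a) : Aug k D).2 := by
  induction N with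
  | zero =>
    rw [prodR, rightAct_augOne, leftAct_augOne]
    exact (sub_self (lam (ofD a) : Aug k D).2).symm
  | succ N ih =>
    have h := rightAct_expStar_neg_ferU ax1 ax2 ax3 a N
    rw [prodR, starA_snd, leftAct_starA p s ax3, rightAct_starA p s ax1, Module.End.mul_apply,
      Module.End.mul_apply, h]
    conv_lhs => rw [ih]
    have hc := LinearMap.congr_fun (commute_leftAct_rightAct p s ax2
      (expStar p s (-ferU p s a N)) (prodR p s (fun n => expStar p s (-ferU p s a n)) N)).eq
      (ferU p s a N).2
    rw [Module.End.mul_apply, Module.End.mul_apply] at hc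
    rw [map_sub, map_add, hc]
    abel

theorem prodL_fst {F : ℕ → Aug k D} (hF : ∀ n, (F n).1 = (augOne : Aug k D).1) (N : ℕ) :
    (prodL p s F N).1 = (augOne : Aug k D).1 := by
  induction N with
  | zero => rfl
  | succ N ih =>
    change bconv (LinearMap.mul k k) (prodL p s F N).1 (F N).1 = _
    rw [ih, bconv_augOne, hF]
    simp

theorem prodR_fst {F : ℕ → Aug k D} (hF : ∀ n, (F n).1 = (augOne : Aug k D).1) (N : ℕ) :
    (prodR p s F N).1 = (augOne : Aug k D).1 := by
  induction N with
  | zero => rfl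
  | succ N ih =>
    change bconv (LinearMap.mul k k) (F N).1 (prodR p s F N).1 = _
    rw [ih, hF, bconv_augOne]
    simp

theorem raises_zero_leftAct (x : Aug k D) : Raises 0 (leftAct s x) :=
  raises_leftAct s x (fun i hi => absurd hi (by omega)) (fun i hi => absurd hi (by omega))

theorem raises_zero_rightAct (x : Aug k D) : Raises 0 (rightAct p x) :=
  raises_zero_leftAct x

theorem leftAct_ofD {x : Aug k D} (hx : x.1 = (augOne : Aug k D).1) (a : D) (n : ℕ) :
    leftAct s x (ofD a : Aug k D).2 n = s (x.2 n) a + if n = 0 then a else 0 := by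
  rw [leftAct_apply, hx, bconv_augOne, Pi.add_apply, bconv, sum_eq_single (n, 0)]
  · simp [ofD]
  · rintro ⟨i, j⟩ h hne
    rw [HasAntidiagonal.mem_antidiagonal] at h
    have : j ≠ 0 := by
      rintro rfl
      exact hne (by rw [← h, add_zero])
    simp [ofD, this]
  · intro h
    simp at h

theorem leftAct_lam_zero (x y : Aug k D) : leftAct s x (lam y).2 0 = 0 := by
  simp [leftAct_apply, bconv, lam]

theorem leftAct_lam_succ (x y : Aug k D) (n : ℕ) :
    leftAct s x (lam y).2 (n + 1) = leftAct s x y.2 n := by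
  rw [leftAct_apply, leftAct_apply, Pi.add_apply, Pi.add_apply, bconv, bconv,
    Nat.sum_antidiagonal_succ', Nat.sum_antidiagonal_succ']
  simp [lam, bconv]

/-- A family of series satisfying, up to increasing order, a common recursion for its
coefficients has diagonal satisfying this recursion. -/
theorem diagonal_recursion {P : ℕ → ℕ → D} {g : ℕ → D → D} (h₀ : ∀ N, P N 0 = 0)
    (h : ∀ N n, n < N → P N (n + 1) = g n (P N n)) (n : ℕ) :
    P (n + 2) (n + 1) = g n (P (n + 1) n) := by
  have hstable : ∀ n N N', n ≤ N → n ≤ N' → P N n = P N' n := by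
    intro n
    induction n with
    | zero => intro N N' _ _; rw [h₀, h₀]
    | succ n ih =>
      intro N N' hN hN'
      rw [h N n hN, h N' n hN', ih N N' (by omega) (by omega)]
  rw [h (n + 2) n (by omega), hstable n (n + 2) (n + 1) (by omega) (by omega)]

end Fer

/-- Pre-Lie Fer expansion.  Let `Ā` be a unital dendriform algebra and `a ∈ A`; with
`U'_0 := λa` and `U'_{n+1} := Σ_{l>0} ((−1)^l l/(l+1)!) L_▷[U'_n]^{(l)}(U'_n)`, the
ordered infinite products `Y = →∏_{n≥0} exp*(U'_n)` and
`Y⁻¹ = ←∏_{n≥0} exp*(−U'_n)` solve `Y = 1 + λ a ≺ Y` and `Y⁻¹ = 1 − λ Y⁻¹ ≻ a`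
respectively. -/
theorem preLie_fer_expansion
    (ax1 : ∀ a b c : D, p (p a b) c = p a (p b c + s b c))
    (ax2 : ∀ a b c : D, p (s a b) c = s a (p b c))
    (ax3 : ∀ a b c : D, s a (s b c) = s (p a b + s a b) c)
    (a : D) (Y Yi : Aug k D)
    (hY : Y = limitProd (prodL p s (fun n => expStar p s (ferU p s a n))))
    (hYi : Yi = limitProd (prodR p s (fun n => expStar p s (-(ferU p s a n))))) :
    Y = augOne + lam (precA p (ofD a) Y) ∧
    Yi = augOne - lam (succA s Yi (ofD a)) := by
  constructor
  · set P := prodL p s (fun n => expStar p s (ferU p s a n)) with hP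
    have hfst : ∀ N, (P N).1 = (augOne : Aug k D).1 :=
      prodL_fst fun n => expStar_fst (ferU_fst a n)
    have hcoeff : ∀ N n, n < N + 1 → (P N).2 n = rightAct p (P N) (lam (ofD a) : Aug k D).2 n := by
      intro N n hn
      conv_lhs => rw [hP, prodL_expStar_snd ax1 ax2 ax3, ← hP]
      rw [Pi.sub_apply, raises_zero_leftAct (P N) _ _ (vanishBelow_ferU a N) n (by omega),
        sub_zero]
    have hzero : ∀ N, (P N).2 0 = 0 := fun N =>
      (hcoeff N 0 (by omega)).trans (leftAct_lam_zero _ _)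
    have hsucc : ∀ N n, n < N → (P N).2 (n + 1) =
        p.flip ((P N).2 n) a + if n = 0 then a else 0 := fun N n hn => by
      rw [hcoeff N (n + 1) (by omega), rightAct, leftAct_lam_succ, leftAct_ofD (hfst N)]
    have hYfst : Y.1 = (augOne : Aug k D).1 := by
      rw [hY]
      funext n
      exact congrFun (hfst (n + 1)) n
    refine Prod.ext ?_ ?_
    · rw [hYfst]
      funext n
      cases n <;> exact (add_zero _).symm
    · funext n
      cases n with
      | zero => simpa [hY, limitProd, augOne, lam] using hzero 1
      | succ n =>
        have h₁ := diagonal_recursion (P := fun N => (P N).2)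
          (g := fun n d => p.flip d a + if n = 0 then a else 0) hzero hsucc n
        have h₂ : Y.2 (n + 1) = rightAct p Y (ofD a : Aug k D).2 n := by
          rw [rightAct, leftAct_ofD hYfst, hY]
          exact h₁
        rw [h₂, rightAct_apply]
        exact (zero_add _).symm
  · set P := prodR p s (fun n => expStar p s (-ferU p s a n)) with hP
    have hfst : ∀ N, (P N).1 = (augOne : Aug k D).1 :=
      prodR_fst fun n => expStar_fst (by rw [Prod.fst_neg, ferU_fst, neg_zero])
    have hcoeff : ∀ N n, n < N + 1 → (P N).2 n = -leftAct s (P N) (lam (ofD a) : Aug k D).2 n := by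
      intro N n hn
      conv_lhs => rw [hP, prodR_expStar_snd ax1 ax2 ax3, ← hP]
      rw [Pi.sub_apply, raises_zero_rightAct (P N) _ _ (vanishBelow_ferU a N) n (by omega),
        zero_sub]
    have hzero : ∀ N, (P N).2 0 = 0 := fun N => by
      rw [hcoeff N 0 (by omega), leftAct_lam_zero, neg_zero]
    have hsucc : ∀ N n, n < N → (P N).2 (n + 1) =
        -(s ((P N).2 n) a + if n = 0 then a else 0) := fun N n hn => by
      rw [hcoeff N (n + 1) (by omega), leftAct_lam_succ, leftAct_ofD (hfst N)]
    have hYfst : Yi.1 = (augOne : Aug k D).1 := by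
      rw [hYi]
      funext n
      exact congrFun (hfst (n + 1)) n
    refine Prod.ext ?_ ?_
    · rw [hYfst]
      funext n
      cases n <;> exact (sub_zero _).symm
    · funext n
      cases n with
      | zero => simpa [hYi, limitProd, augOne, lam] using hzero 1
      | succ n =>
        have h₁ := diagonal_recursion (P := fun N => (P N).2)
          (g := fun n d => -(s d a + if n = 0 then a else 0)) hzero hsucc n
        have h₂ : Yi.2 (n + 1) = -leftAct s Yi (ofD a : Aug k D).2 n := by
          rw [leftAct_ofD hYfst, hYi]
          exact h₁
        rw [h₂, leftAct_apply]
        exact (zero_sub _).symm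

end DendriformAug
end

section
/- Let D be a dendriform algebra and a, b, c ∈ D. Let X ∈ D̄[[λ]] be the solution of the degree (2,0) equation X = 1 + λ X ≻ c + λ² (X ≻ b) ≻ a. Then the row vector Y := (X, λ X ≻ b) in (D̄[[λ]])² is the solution of the vector equation Y = v·1₂ + λ Y ≻ M with v = (1, 0) ∈ k² and M the 2×2 matrix with rows (c, b) and (a, 0), where Y ≻ M := (Y₁ ≻ M₁₁ + Y₂ ≻ M₂₁, Y₁ ≻ M₁₂ + Y₂ ≻ M₂₂). -/
open Finset

section DendriformAug

variable {k : Type} [Field k] [CharZero k]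
variable {D : Type} [AddCommGroup D] [Module k D]

variable (p s : D →ₗ[k] D →ₗ[k] D)

theorem lam_add_series (x y : Aug k D) : lam (x + y) = lam x + lam y := by
  ext n <;> cases n <;> simp [lam]

theorem succA_lam_left (x y : Aug k D) : succA s (lam x) y = lam (succA s x y) := by
  ext n
  · cases n <;> simp [succA, lam]
  · cases n <;> simp [succA, lam, conv, sconv, Finset.Nat.antidiagonal_succ]

theorem succA_ofD_zero (x : Aug k D) : succA s x (ofD 0) = 0 := by
  ext n <;> simp [succA, ofD, conv, sconv]

/-- Let `D` be a dendriform algebra, `a b c ∈ D`, and `X ∈ D̄[[λ]]` the solution of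
the degree `(2,0)` equation `X = 1 + λ X ≻ c + λ² (X ≻ b) ≻ a`.  Then the row vector
`Y := (X, λ X ≻ b)` solves the vector equation `Y = v·1₂ + λ Y ≻ M` with
`v = (1, 0) ∈ k²` and `M` the matrix with rows `(c, b)` and `(a, 0)`, where
`(Y ≻ M)_j := Σ_i Y_i ≻ M_{ij}`. -/
theorem dendriform_degree_two_zero_to_vector
    (ax1 : ∀ a b c : D, p (p a b) c = p a (p b c + s b c))
    (ax2 : ∀ a b c : D, p (s a b) c = s a (p b c))
    (ax3 : ∀ a b c : D, s a (s b c) = s (p a b + s a b) c)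
    (a b c : D) (X : Aug k D)
    (hX : X = augOne + lam (succA s X (ofD c))
      + lam (lam (succA s (succA s X (ofD b)) (ofD a))))
    (M : Matrix (Fin 2) (Fin 2) D) (hM : M = !![c, b; a, 0])
    (v : Fin 2 → k) (hv : v = ![1, 0])
    (Y : Fin 2 → Aug k D) (hY : Y = ![X, lam (succA s X (ofD b))]) :
    ∀ j : Fin 2,
      Y j = v j • augOne + lam (∑ i : Fin 2, succA s (Y i) (ofD (M i j))) := by
  subst hM hv hY
  intro j
  fin_cases j
  · simpa [Fin.sum_univ_two, succA_lam_left, lam_add_series, add_assoc] using hX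
  · simp [Fin.sum_univ_two, succA_ofD_zero]

end DendriformAug
end

section
/- Let (A, R) be an associative Rota–Baxter algebra of weight θ over a field k of characteristic zero. Then the three bilinear operations a < b := aR(b), a > b := R(a)b, a •_θ b := θab turn A into a tridendriform algebra, i.e. they satisfy the seven tridendriform axioms. -/
/-- If `(A, R)` is an associative Rota–Baxter algebra of weight `θ` over a field `k`
of characteristic zero, then `a < b := a·R(b)`, `a > b := R(a)·b`,
`a •_θ b := θ·a·b` turn `A` into a tridendriform algebra: the seven tridendriform
axioms hold. -/
theorem rotaBaxter_tridendriform
    (k : Type) [Field k] [CharZero k]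
    (A : Type) [Ring A] [Algebra k A]
    (R : A →ₗ[k] A) (θ : k)
    (hRB : ∀ a b : A, R a * R b = R (R a * b + a * R b + θ • (a * b)))
    (lt gt bu : A → A → A)
    (hlt : ∀ a b : A, lt a b = a * R b)
    (hgt : ∀ a b : A, gt a b = R a * b)
    (hbu : ∀ a b : A, bu a b = θ • (a * b)) :
    (∀ x y z : A, lt (lt x y) z = lt x (lt y z + gt y z + bu y z)) ∧
    (∀ x y z : A, lt (gt x y) z = gt x (lt y z)) ∧
    (∀ x y z : A, gt (lt x y + gt x y + bu x y) z = gt x (gt y z)) ∧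
    (∀ x y z : A, bu (gt x y) z = gt x (bu y z)) ∧
    (∀ x y z : A, bu (lt x y) z = bu x (gt y z)) ∧
    (∀ x y z : A, lt (bu x y) z = bu x (lt y z)) ∧
    (∀ x y z : A, bu (bu x y) z = bu x (bu y z)) := by
  have hR (a b : A) : R (a * R b + R a * b + θ • (a * b)) = R a * R b := by
    rw [hRB, add_comm (a * R b)]
  simp only [hlt, hgt, hbu, hR]
  refine ⟨?_, ?_, ?_, ?_, ?_, ?_, ?_⟩ <;> intro x y z <;>
    simp only [mul_assoc, smul_mul_assoc, mul_smul_comm]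
end

section
/- Let (A, R) be an associative Rota–Baxter algebra of weight θ over a field k of characteristic zero. Then the bilinear operations a ≺ b := aR(b) + θab = −a·R̃(b) and a ≻ b := R(a)b, where R̃ := −θ·id − R, turn A into a dendriform algebra. Moreover, the associated left and right pre-Lie products are given explicitly by a ▷ b := a ≻ b − b ≺ a = [R(a), b] − θba and a ◁ b := a ≺ b − b ≻ a = [a, R(b)] + θab, where [x, y] := xy − yx. -/
/-- If `(A, R)` is an associative Rota–Baxter algebra of weight `θ` over a field `k`
of characteristic zero, then `a ≺ b := a·R(b) + θ·a·b = −a·R̃(b)` (with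
`R̃ := −θ·id − R`) and `a ≻ b := R(a)·b` turn `A` into a dendriform algebra, and the
associated pre-Lie products are `a ▷ b = [R(a), b] − θ·b·a` and
`a ◁ b = [a, R(b)] + θ·a·b`. -/
theorem rotaBaxter_dendriform
    (k : Type) [Field k] [CharZero k]
    (A : Type) [Ring A] [Algebra k A]
    (R : A →ₗ[k] A) (θ : k)
    (hRB : ∀ a b : A, R a * R b = R (R a * b + a * R b + θ • (a * b)))
    (prec succ : A → A → A)
    (hprec : ∀ a b : A, prec a b = a * R b + θ • (a * b))
    (hsucc : ∀ a b : A, succ a b = R a * b) :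
    (∀ a b : A, prec a b = -(a * (-(θ • b) - R b))) ∧
    (∀ a b c : A, prec (prec a b) c = prec a (prec b c + succ b c)) ∧
    (∀ a b c : A, prec (succ a b) c = succ a (prec b c)) ∧
    (∀ a b c : A, succ a (succ b c) = succ (prec a b + succ a b) c) ∧
    (∀ a b : A, succ a b - prec b a = (R a * b - b * R a) - θ • (b * a)) ∧
    (∀ a b : A, prec a b - succ b a = (a * R b - R b * a) + θ • (a * b)) := by
  have hR : ∀ a b : A, R (prec a b + succ a b) = R a * R b := fun a b => by
    rw [hRB, hprec, hsucc]
    congr 1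
    abel
  refine ⟨fun a b => ?_, fun a b c => ?_, fun a b c => ?_, fun a b c => ?_, fun a b => ?_,
    fun a b => ?_⟩
  · rw [hprec, mul_sub, mul_neg, mul_smul_comm]
    abel
  · rw [hprec (prec a b), hprec a (_ + _), hR]
    simp only [hprec, hsucc, add_mul, mul_add, smul_mul_assoc, mul_smul_comm, smul_add, mul_assoc]
    abel
  · simp only [hprec, hsucc, mul_add, mul_smul_comm, mul_assoc]
  · rw [hsucc (_ + _), hR, hsucc, hsucc, mul_assoc]
  · rw [hprec, hsucc]
    abel
  · rw [hprec, hsucc]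
    abel
end
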